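/- arXiv:2304.10255 — 3 statements merged into one kernel-verified Lean document; each statement's English description precedes it below -/
import Mathlib

section
/- Let D ≥ 2, let X_d ⊆ ℝ and X_{-d} ⊆ ℝ^{D-1} be measurable sets of finite positive Lebesgue measure, and let X = X_d × X_{-d}. Let A′ ⊆ A ⊆ X be measurable sets with μ_D(A) = γ · μ_D(X) and μ_D(A′) = γ′ · μ_D(X), where 0 < γ′ < γ ≤ 1. Define V_d(t) = μ_{D-1}({y ∈ X_{-d} : (t,y) ∈ A}) and V′_d(t) = μ_{D-1}({y ∈ X_{-d} : (t,y) ∈ A′}), the marginal densities p_d(t) = V_d(t)/(γ · μ_D(X)) and p′_d(t) = V′_d(t)/(γ′ · μ_D(X)), and the local marginal mean f_d^γ(t) = V′_d(t)/V_d(t) when V_d(t) > 0 and f_d^γ(t) = 1 otherwise. Then the local marginal variance satisfies v_d^γ := ∫_{X_d} (f_d^γ(t) − γ′/γ)² · p_d(t) dt = (γ′/γ)² · ∫_{X_d} (p′_d(t)/p_d(t) − 1)² · p_d(t) dt, where the integrand of the right-hand side is taken to be 0 wherever p_d(t) = 0; that is, v_d^γ = (γ′/γ)² times the Pearson divergence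 between p′_d and p_d. -/
open MeasureTheory

theorem stmt_2 (D : ℕ) (hD : 2 ≤ D)
    (Xd : Set ℝ) (Xrest : Set (Fin (D - 1) → ℝ))
    (hXd : MeasurableSet Xd) (hXrest : MeasurableSet Xrest)
    (hXd_pos : 0 < volume Xd) (hXd_fin : volume Xd < ⊤)
    (hXrest_pos : 0 < volume Xrest) (hXrest_fin : volume Xrest < ⊤)
    (A A' : Set (ℝ × (Fin (D - 1) → ℝ)))
    (hA : MeasurableSet A) (hA' : MeasurableSet A')
    (hA'A : A' ⊆ A) (hAX : A ⊆ Xd ×ˢ Xrest)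
    (γ γ' : ℝ) (hγ'_pos : 0 < γ') (hγ'γ : γ' < γ) (hγ : γ ≤ 1)
    (hvolA : volume A = ENNReal.ofReal γ * volume (Xd ×ˢ Xrest))
    (hvolA' : volume A' = ENNReal.ofReal γ' * volume (Xd ×ˢ Xrest)) :
    ∫ t in Xd,
      ((if 0 < volume {y ∈ Xrest | (t, y) ∈ A} then
          (volume {y ∈ Xrest | (t, y) ∈ A'}).toReal
            / (volume {y ∈ Xrest | (t, y) ∈ A}).toReal
        else 1) - γ' / γ) ^ 2
        * ((volume {y ∈ Xrest | (t, y) ∈ A}).toReal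
            / (γ * (volume (Xd ×ˢ Xrest)).toReal))
      =
    (γ' / γ) ^ 2 *
      ∫ t in Xd,
        ((volume {y ∈ Xrest | (t, y) ∈ A'}).toReal
            / (γ' * (volume (Xd ×ˢ Xrest)).toReal)
          / ((volume {y ∈ Xrest | (t, y) ∈ A}).toReal
            / (γ * (volume (Xd ×ˢ Xrest)).toReal)) - 1) ^ 2
          * ((volume {y ∈ Xrest | (t, y) ∈ A}).toReal
            / (γ * (volume (Xd ×ˢ Xrest)).toReal)) := by
  have hγ_pos : 0 < γ := hγ'_pos.trans hγ'γ
  have hX_pos : 0 < (volume (Xd ×ˢ Xrest)).toReal := by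
    rw [Measure.volume_eq_prod, Measure.prod_prod]
    exact ENNReal.toReal_pos (mul_ne_zero hXd_pos.ne' hXrest_pos.ne')
      (ENNReal.mul_ne_top hXd_fin.ne hXrest_fin.ne)
  rw [← integral_const_mul]
  congr 1 with t
  split_ifs with hV
  · have hV_fin : volume {y ∈ Xrest | (t, y) ∈ A} ≠ ⊤ :=
      measure_ne_top_of_subset (Set.sep_subset _ _) hXrest_fin.ne
    have hV_pos := ENNReal.toReal_pos hV.ne' hV_fin
    field_simp
  · simp [nonpos_iff_eq_zero.mp (not_lt.mp hV)]
end

section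
/- Let f : ℝ² → ℝ be defined by f(x₁,x₂) = x₁² + x₂² if x₁² + x₂² ≥ 3, and f(x₁,x₂) = x₁² + x₂²/100 otherwise. For every x₁ ∈ [−5, 5], the marginal mean f₁(x₁) = (1/10) ∫_{−5}^{5} f(x₁, x₂) dx₂ equals x₁² + 25/3 − (33/500) · (max(3 − x₁², 0))^{3/2}; in particular f₁(x₁) = x₁² + 25/3 for |x₁| ≥ √3. -/
open MeasureTheory Real

/-- The paper's toy function. -/
noncomputable def toyF (x₁ x₂ : ℝ) : ℝ :=
  if 3 ≤ x₁ ^ 2 + x₂ ^ 2 then x₁ ^ 2 + x₂ ^ 2 else x₁ ^ 2 + x₂ ^ 2 / 100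

/-- The toy function is the paraboloid minus a correction supported on `|x₂| < √(3 - x₁²)`. -/
lemma toyF_eq_sub_indicator (x y : ℝ) :
    toyF x y = (x ^ 2 + y ^ 2) -
      (Set.Ioo (-√(3 - x ^ 2)) (√(3 - x ^ 2))).indicator (fun t => 99 / 100 * t ^ 2) y := by
  have hmem : y ∈ Set.Ioo (-√(3 - x ^ 2)) (√(3 - x ^ 2)) ↔ ¬ 3 ≤ x ^ 2 + y ^ 2 := by
    rw [Set.mem_Ioo, ← abs_lt, Real.lt_sqrt (abs_nonneg y), sq_abs, not_le]
    constructor <;> intro h <;> linarith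
  by_cases h : 3 ≤ x ^ 2 + y ^ 2
  · rw [Set.indicator_of_notMem (by simpa [hmem] using h), toyF, if_pos h, sub_zero]
  · rw [Set.indicator_of_mem (hmem.2 h), toyF, if_neg h]
    ring

lemma intervalIntegral_indicator_Ioo {a b r : ℝ} {g : ℝ → ℝ} (ha : a ≤ -r) (hb : r ≤ b)
    (hr : 0 ≤ r) :
    ∫ t in a..b, (Set.Ioo (-r) r).indicator g t = ∫ t in (-r)..r, g t := by
  rw [intervalIntegral.integral_of_le (by linarith), intervalIntegral.integral_of_le (by linarith),
    setIntegral_indicator measurableSet_Ioo, integral_Ioc_eq_integral_Ioo,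
    Set.inter_eq_self_of_subset_right]
  exact fun t ht => ⟨ha.trans_lt ht.1, ht.2.le.trans hb⟩

lemma marginal_mean_toyF (x : ℝ) :
    (1 / 10) * ∫ y in (-5 : ℝ)..5, toyF x y =
      x ^ 2 + 25 / 3 - (33 / 500) * √(3 - x ^ 2) ^ 3 := by
  have hr : √(3 - x ^ 2) ≤ 5 := Real.sqrt_le_iff.2 ⟨by norm_num, by nlinarith [sq_nonneg x]⟩
  have hcorr : IntervalIntegrable
      ((Set.Ioo (-√(3 - x ^ 2)) (√(3 - x ^ 2))).indicator fun t => 99 / 100 * t ^ 2)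
      volume (-5) 5 := by
    have hg : IntervalIntegrable (fun t : ℝ => 99 / 100 * t ^ 2) volume (-5) 5 :=
      Continuous.intervalIntegrable (by fun_prop) _ _
    exact ⟨hg.1.indicator measurableSet_Ioo, hg.2.indicator measurableSet_Ioo⟩
  simp_rw [toyF_eq_sub_indicator]
  rw [intervalIntegral.integral_sub (Continuous.intervalIntegrable (by fun_prop) _ _) hcorr,
    intervalIntegral_indicator_Ioo (by linarith) hr (Real.sqrt_nonneg _),
    intervalIntegral.integral_add (by simp) (Continuous.intervalIntegrable (by fun_prop) _ _),
    intervalIntegral.integral_const_mul, integral_pow, integral_pow,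
    intervalIntegral.integral_const, smul_eq_mul]
  norm_num
  ring

lemma max_zero_rpow_three_halves (a : ℝ) : max a 0 ^ ((3 : ℝ) / 2) = √a ^ 3 := by
  have hsqrt : √a = √(max a 0) := by
    rcases le_total a 0 with h | h
    · rw [max_eq_right h, Real.sqrt_eq_zero_of_nonpos h, Real.sqrt_zero]
    · rw [max_eq_left h]
  rw [hsqrt, Real.sqrt_eq_rpow, ← Real.rpow_natCast, ← Real.rpow_mul (le_max_right a 0)]
  norm_num

theorem stmt_7 :
    (∀ x₁ ∈ Set.Icc (-5 : ℝ) 5,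
      (1 / 10) * ∫ x₂ in (-5 : ℝ)..5, toyF x₁ x₂
        = x₁ ^ 2 + 25 / 3 - (33 / 500) * (max (3 - x₁ ^ 2) 0) ^ ((3 : ℝ) / 2)) ∧
    (∀ x₁ ∈ Set.Icc (-5 : ℝ) 5, Real.sqrt 3 ≤ |x₁| →
      (1 / 10) * ∫ x₂ in (-5 : ℝ)..5, toyF x₁ x₂ = x₁ ^ 2 + 25 / 3) := by
  refine ⟨fun x _ => ?_, fun x _ hx => ?_⟩
  · rw [marginal_mean_toyF, max_zero_rpow_three_halves]
  · have h3 : 3 ≤ x ^ 2 := by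
      rwa [Real.sqrt_le_left (abs_nonneg x), sq_abs] at hx
    rw [marginal_mean_toyF, Real.sqrt_eq_zero_of_nonpos (by linarith)]
    ring
end

section
/- Let f : ℝ² → ℝ be defined by f(x₁,x₂) = x₁² + x₂² if x₁² + x₂² ≥ 3, and f(x₁,x₂) = x₁² + x₂²/100 otherwise. For every x₁ with |x₁| < √3, the local marginal mean over the disk x₁² + x₂² ≤ 3 satisfies f₁^γ(x₁) := (1/(2√(3 − x₁²))) ∫_{−√(3 − x₁²)}^{√(3 − x₁²)} f(x₁, x₂) dx₂ = 1/100 + (299/300)·x₁². -/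
open MeasureTheory Real

theorem stmt_10 (x₁ : ℝ) (hx₁ : |x₁| < Real.sqrt 3) :
    (1 / (2 * Real.sqrt (3 - x₁ ^ 2))) *
      ∫ x₂ in (-Real.sqrt (3 - x₁ ^ 2))..(Real.sqrt (3 - x₁ ^ 2)), toyF x₁ x₂
      = 1 / 100 + (299 / 300) * x₁ ^ 2 := by
  have hpos : 0 < 3 - x₁ ^ 2 := by
    have := (Real.lt_sqrt (abs_nonneg x₁)).mp hx₁
    rw [sq_abs] at this
    linarith
  have hsq : Real.sqrt (3 - x₁ ^ 2) ^ 2 = 3 - x₁ ^ 2 := Real.sq_sqrt hpos.le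
  have hs : 0 < Real.sqrt (3 - x₁ ^ 2) := Real.sqrt_pos.mpr hpos
  generalize Real.sqrt (3 - x₁ ^ 2) = s at hsq hs ⊢
  have hint : ∫ x₂ in (-s)..s, toyF x₁ x₂ = ∫ x₂ in (-s)..s, (x₁ ^ 2 + x₂ ^ 2 / 100) := by
    apply intervalIntegral.integral_congr_ae
    filter_upwards [Measure.ae_ne volume s] with y hy hmem
    rw [Set.uIoc_of_le (by linarith)] at hmem
    have hlt : y < s := lt_of_le_of_ne hmem.2 hy
    have : y ^ 2 < s ^ 2 := sq_lt_sq' hmem.1 hlt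
    rw [toyF, if_neg (by linarith)]
  rw [hint, intervalIntegral.integral_add (Continuous.intervalIntegrable (by fun_prop) _ _)
    (Continuous.intervalIntegrable (by fun_prop) _ _), intervalIntegral.integral_div,
    integral_pow, intervalIntegral.integral_const, smul_eq_mul]
  have hx : x₁ ^ 2 = 3 - s ^ 2 := by linarith
  rw [hx]
  field_simp
  ring
end
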